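/- arXiv:2602.12579 — 2 statements merged into one kernel-verified Lean document; each statement's English description precedes it below -/
import Mathlib

section
/- Let (X, 𝒜, μ) be a probability space, (Y, ℬ) a measurable space, and κ a Markov kernel from X to Y; let ν := μ ⊗ κ denote the joint law on X × Y. Let g : X × Y → ℝ^d be jointly measurable with ∫ ‖g‖² dν < ∞. Let w : X → {0,1} be measurable with β := ∫ w dμ ∈ (0, 1], and define the estimator ĝ(x, y) := (w(x)/β) g(x, y) and the conditional mean ḡ(x) := ∫ g(x, y) κ(x)(dy). Define the vector variance Var(Z) := E‖Z − E[Z]‖², the within-prompt (action) variance σ² := E[Var_{Y|X}(g) | w(X) = 1] = (1/β) ∫ w(x) (∫ ‖g(x,y) − ḡ(x)‖² κ(x)(dy)) dμ(x), and the across-prompt (problem) variance V_prob := Var(ḡ(X) | w(X)=1), the vector variance of ḡ under the conditional measure μ(· | w = 1). Let m := ∫ ĝ dν denote the mean of the estimator. Then Var(ĝ) = σ²/β + V_prob/β + ((1 − β)/β) ‖m‖². -/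
open MeasureTheory ProbabilityTheory

/-- Vector-valued version of `Var Z = E‖Z‖² - ‖E Z‖²`. -/
theorem integral_norm_sub_integral_sq {Ω E : Type*} [MeasurableSpace Ω]
    [NormedAddCommGroup E] [InnerProductSpace ℝ E] [CompleteSpace E]
    (P : Measure Ω) [IsProbabilityMeasure P] {f : Ω → E} (hf : MemLp f 2 P) :
    ∫ ω, ‖f ω - ∫ ω', f ω' ∂P‖ ^ 2 ∂P = (∫ ω, ‖f ω‖ ^ 2 ∂P) - ‖∫ ω, f ω ∂P‖ ^ 2 := by
  have hint : Integrable f P := hf.integrable (by norm_num)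
  have hsq : Integrable (fun ω => ‖f ω‖ ^ 2) P := hf.integrable_norm_pow two_ne_zero
  set c := ∫ ω, f ω ∂P with hc
  have hinner : Integrable (fun ω => inner ℝ c (f ω)) P := hint.const_inner c
  have hexp : ∀ ω, ‖f ω - c‖ ^ 2 = ‖f ω‖ ^ 2 - 2 * inner ℝ c (f ω) + ‖c‖ ^ 2 := fun ω => by
    rw [norm_sub_sq_real, real_inner_comm]
  simp_rw [hexp]
  rw [integral_add (f := fun ω => ‖f ω‖ ^ 2 - 2 * inner ℝ c (f ω))
      (hsq.sub (hinner.const_mul 2)) (integrable_const _),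
    integral_sub hsq (hinner.const_mul 2), integral_const_mul, integral_inner hint c, ← hc,
    real_inner_self_eq_norm_sq]
  simp
  ring

/-- Conditioning on the event `w = 1`, for a `{0, 1}`-valued mask `w`, reweights by `w / E w`. -/
theorem integral_cond_eq_inv_smul_integral_smul {X E : Type*} [MeasurableSpace X]
    [NormedAddCommGroup E] [NormedSpace ℝ E] (μ : Measure X) {w : X → ℝ} (hw : Measurable w)
    (hw01 : ∀ x, w x = 0 ∨ w x = 1) (f : X → E) :
    ∫ x, f x ∂(μ[|{x' | w x' = 1}]) = (∫ x, w x ∂μ)⁻¹ • ∫ x, w x • f x ∂μ := by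
  have hA : MeasurableSet {x' | w x' = 1} := hw (measurableSet_singleton 1)
  have hwf : (fun x => w x • f x) = {x' | w x' = 1}.indicator f := by
    funext x
    rcases hw01 x with hx | hx <;> simp [Set.indicator, hx]
  have hw' : w = {x' | w x' = 1}.indicator 1 := by
    ext x
    rcases hw01 x with hx | hx <;> simp [Set.indicator, hx]
  have hβ : ∫ x, w x ∂μ = μ.real {x' | w x' = 1} := by
    conv_lhs => rw [hw']
    exact integral_indicator_one hA
  rw [hβ, hwf, integral_indicator hA, ProbabilityTheory.cond, integral_smul_measure,
    ENNReal.toReal_inv, measureReal_def]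

/-- **Theorem 2 (Variance Decomposition).**
For the curriculum estimator `ghat (x, y) = (w x / β) • g (x, y)` on `ν = μ ⊗ₘ κ`, with
`β = ∫ w dμ ∈ (0, 1]`, conditional mean `gbar x = ∫ g (x, y) dκ(x)`, action variance
`σ² = (1/β) ∫ w x (∫ ‖g (x,y) − gbar x‖² dκ(x)) dμ`, problem variance
`V_prob = Var(gbar | w = 1)` (the vector variance of `gbar` under `μ[|{w = 1}]`), and
estimator mean `m = ∫ ghat dν`, we have
`Var(ghat) = σ²/β + V_prob/β + ((1 − β)/β) ‖m‖²`. -/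
theorem variance_decomposition
    {X Y : Type*} [MeasurableSpace X] [MeasurableSpace Y]
    (μ : Measure X) [IsProbabilityMeasure μ]
    (κ : Kernel X Y) [IsMarkovKernel κ]
    {d : ℕ} (g : X × Y → EuclideanSpace ℝ (Fin d)) (hg : Measurable g)
    (hg2 : Integrable (fun p => ‖g p‖ ^ 2) (μ ⊗ₘ κ))
    (w : X → ℝ) (hw : Measurable w) (hw01 : ∀ x, w x = 0 ∨ w x = 1)
    (β : ℝ) (hβ : β = ∫ x, w x ∂μ) (hβ0 : 0 < β) (hβ1 : β ≤ 1)
    (ghat : X × Y → EuclideanSpace ℝ (Fin d))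
    (hghat : ghat = fun p => (w p.1 / β) • g p)
    (gbar : X → EuclideanSpace ℝ (Fin d))
    (hgbar : gbar = fun x => ∫ y, g (x, y) ∂(κ x))
    (σ2 : ℝ)
    (hσ2 : σ2 = (1 / β) * ∫ x, w x * ∫ y, ‖g (x, y) - gbar x‖ ^ 2 ∂(κ x) ∂μ)
    (Vprob : ℝ)
    (hVprob : Vprob
      = ∫ x, ‖gbar x - ∫ x', gbar x' ∂(μ[|{x' | w x' = 1}])‖ ^ 2 ∂(μ[|{x' | w x' = 1}]))
    (m : EuclideanSpace ℝ (Fin d)) (hm : m = ∫ p, ghat p ∂(μ ⊗ₘ κ)) :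
    (∫ p, ‖ghat p - m‖ ^ 2 ∂(μ ⊗ₘ κ))
      = σ2 / β + Vprob / β + ((1 - β) / β) * ‖m‖ ^ 2 := by
  have hν : MemLp g 2 (μ ⊗ₘ κ) :=
    (memLp_two_iff_integrable_sq_norm hg.aestronglyMeasurable).2 hg2
  have hwm : Measurable fun p : X × Y => w p.1 := hw.comp measurable_fst
  have hwn : ∀ x, ‖w x‖ ≤ 1 := fun x => by rcases hw01 x with h | h <;> simp [h]
  have hww : ∀ x, w x ^ 2 = w x := fun x => by rcases hw01 x with h | h <;> simp [h]
  have hne : β ≠ 0 := hβ0.ne'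
  have hg2' := (Measure.integrable_compProd_iff hg2.aestronglyMeasurable).1 hg2
  have hfib : ∀ᵐ x ∂μ, MemLp (fun y => g (x, y)) 2 (κ x) := by
    filter_upwards [hg2'.1] with x hx
    exact (memLp_two_iff_integrable_sq_norm
      (hg.comp measurable_prodMk_left).aestronglyMeasurable).2 hx
  have hvar : ∀ᵐ x ∂μ, ∫ y, ‖g (x, y) - gbar x‖ ^ 2 ∂(κ x)
      = (∫ y, ‖g (x, y)‖ ^ 2 ∂(κ x)) - ‖gbar x‖ ^ 2 := by
    filter_upwards [hfib] with x hx
    rw [hgbar]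
    exact integral_norm_sub_integral_sq (κ x) hx
  have hN : Integrable (fun x => ∫ y, ‖g (x, y)‖ ^ 2 ∂(κ x)) μ := by
    simpa using hg2'.2
  have hgbm : StronglyMeasurable gbar := by
    rw [hgbar]
    exact hg.stronglyMeasurable.integral_kernel_prod_right'
  have hG : Integrable (fun x => ‖gbar x‖ ^ 2) μ := by
    refine hN.mono' (hgbm.norm.pow 2).aestronglyMeasurable ?_
    filter_upwards [hvar] with x hx
    have h0 : 0 ≤ ∫ y, ‖g (x, y) - gbar x‖ ^ 2 ∂(κ x) := integral_nonneg fun y => by positivity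
    rw [Real.norm_of_nonneg (by positivity)]
    linarith
  have hwN : Integrable (fun x => w x * ∫ y, ‖g (x, y)‖ ^ 2 ∂(κ x)) μ :=
    hN.bdd_mul hw.aestronglyMeasurable (ae_of_all _ hwn)
  have hwG : Integrable (fun x => w x * ‖gbar x‖ ^ 2) μ :=
    hG.bdd_mul hw.aestronglyMeasurable (ae_of_all _ hwn)
  have hσ : σ2 = (1 / β) * ((∫ x, w x * ∫ y, ‖g (x, y)‖ ^ 2 ∂(κ x) ∂μ)
      - ∫ x, w x * ‖gbar x‖ ^ 2 ∂μ) := by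
    rw [hσ2, ← integral_sub hwN hwG]
    congr 1
    refine integral_congr_ae ?_
    filter_upwards [hvar] with x hx
    rw [hx, mul_sub]
  have hghat_memLp : MemLp ghat 2 (μ ⊗ₘ κ) := by
    refine MemLp.of_le_mul (c := 1 / β) hν ?_ (ae_of_all _ fun p => ?_)
    · rw [hghat]
      exact ((hwm.div_const β).smul hg).aestronglyMeasurable
    · rw [hghat, norm_smul, norm_div, Real.norm_of_nonneg hβ0.le]
      gcongr
      exact hwn _
  have hm' : m = β⁻¹ • ∫ x, w x • gbar x ∂μ := by
    rw [hm, Measure.integral_compProd (hghat_memLp.integrable (by norm_num)), ← integral_smul]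
    simp only [hghat, hgbar, integral_smul, smul_smul, div_eq_inv_mul]
  have hsecond : ∫ p, ‖ghat p‖ ^ 2 ∂(μ ⊗ₘ κ)
      = (β ^ 2)⁻¹ * ∫ x, w x * ∫ y, ‖g (x, y)‖ ^ 2 ∂(κ x) ∂μ := by
    have hexp : ∀ p, ‖ghat p‖ ^ 2 = (β ^ 2)⁻¹ * w p.1 * ‖g p‖ ^ 2 := fun p => by
      rw [hghat, norm_smul, mul_pow, Real.norm_eq_abs, sq_abs, div_pow, hww]
      ring
    rw [Measure.integral_compProd (hghat_memLp.integrable_norm_pow two_ne_zero),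
      ← integral_const_mul]
    simp only [hexp, integral_const_mul, mul_assoc]
  have hA : μ {x' | w x' = 1} ≠ 0 := by
    intro h0
    have hz : w =ᵐ[μ] 0 := by
      filter_upwards [measure_eq_zero_iff_ae_notMem.1 h0] with x hx
      exact (hw01 x).resolve_right hx
    rw [integral_congr_ae hz] at hβ
    simp [hne] at hβ
  have : IsProbabilityMeasure (μ[|{x' | w x' = 1}]) := cond_isProbabilityMeasure hA
  have hgbar_memLp : MemLp gbar 2 (μ[|{x' | w x' = 1}]) := by
    refine ((memLp_two_iff_integrable_sq_norm hgbm.aestronglyMeasurable).2 hG).restrict _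
      |>.smul_measure ?_
    simpa using hA
  have hV : Vprob = β⁻¹ * (∫ x, w x * ‖gbar x‖ ^ 2 ∂μ) - ‖m‖ ^ 2 := by
    rw [hVprob, integral_norm_sub_integral_sq _ hgbar_memLp,
      integral_cond_eq_inv_smul_integral_smul μ hw hw01,
      integral_cond_eq_inv_smul_integral_smul μ hw hw01, ← hβ, ← hm']
    simp only [smul_eq_mul]
  have hL := integral_norm_sub_integral_sq (μ ⊗ₘ κ) hghat_memLp
  rw [← hm] at hL
  rw [hL, hsecond, hσ, hV]
  field_simp
  ring
end

section
/- Let (X, 𝒜, μ) be a probability space and ḡ : X → ℝ^d a measurable function with ∫ ‖ḡ‖² dμ < ∞. Let w : X → {0,1} be measurable with β := ∫ w dμ ∈ (0, 1], and let m := ∫ (w(x)/β) ḡ(x) dμ(x). Then the vector variance of the reweighted conditional mean satisfies ∫ ‖(w(x)/β) ḡ(x) − m‖² dμ(x) = V_prob/β + ((1 − β)/β) ‖m‖², where V_prob := ∫ ‖ḡ(x) − m‖² dμ(· | w = 1)(dx) is the vector variance of ḡ under the conditional probability measure μ(· | w = 1) (in particular m equals the mean of ḡ under μ(· | w = 1)).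 -/
open MeasureTheory ProbabilityTheory

/-- Integration against the conditional measure on `{w = 1}` is integration against the reweighting
by the `{0, 1}`-valued mask `w`, normalized by its mean. -/
theorem integral_cond_mask_eq {X E : Type*} [MeasurableSpace X] [NormedAddCommGroup E]
    [NormedSpace ℝ E] (μ : Measure X) {w : X → ℝ} (hw : Measurable w)
    (hw01 : ∀ x, w x = 0 ∨ w x = 1) (f : X → E) :
    ∫ x, f x ∂(μ[|{x' | w x' = 1}]) = ∫ x, (w x / ∫ y, w y ∂μ) • f x ∂μ := by
  have hs : MeasurableSet {x | w x = 1} := hw (measurableSet_singleton 1)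
  have hw_eq : w = {x | w x = 1}.indicator 1 := by
    ext x
    rcases hw01 x with h | h <;> simp [h]
  have hmean : ∫ y, w y ∂μ = μ.real {x | w x = 1} := by
    conv_lhs => rw [hw_eq]
    exact integral_indicator_one hs
  have hsmul : {x | w x = 1}.indicator f = fun x => w x • f x := by
    ext1 x
    rcases hw01 x with h | h <;> simp [h]
  rw [ProbabilityTheory.cond, integral_smul_measure, ← integral_indicator hs, hsmul, hmean,
    ENNReal.toReal_inv, ← Measure.real, ← integral_smul]
  simp only [smul_smul, div_eq_inv_mul]

/-- Pointwise expansion of the deviation of a masked vector from `m`. -/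
theorem norm_sq_mask_smul_sub {E : Type*} [NormedAddCommGroup E] [InnerProductSpace ℝ E]
    (g m : E) {a β : ℝ} (ha : a = 0 ∨ a = 1) (hβ : β ≠ 0) :
    ‖(a / β) • g - m‖ ^ 2 = β⁻¹ * ((a / β) • ‖g - m‖ ^ 2)
      + 2 * (β⁻¹ - 1) * inner ℝ m ((a / β) • g) + ‖m‖ ^ 2 * (1 - β⁻¹ ^ 2 * a) := by
  rw [norm_sub_sq_real, norm_sub_sq_real, norm_smul, mul_pow, Real.norm_eq_abs, sq_abs,
    real_inner_smul_left, real_inner_smul_right, real_inner_comm, smul_eq_mul]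
  rcases ha with rfl | rfl <;> field_simp <;> ring

/-- The vector variance over prompts of the reweighted conditional mean
`(w x / β) • gbar x` decomposes as `V_prob / β + ((1 − β)/β) ‖m‖²`, where
`m = ∫ (w/β) • gbar dμ` and `V_prob = ∫ ‖gbar − m‖² dμ[|{w = 1}]` is the vector
variance of `gbar` under the conditional measure `μ[|{w = 1}]`; in particular
`m` equals the mean of `gbar` under `μ[|{w = 1}]`. -/
theorem problem_and_masking_variance_decomposition
    {X : Type*} [MeasurableSpace X] (μ : Measure X) [IsProbabilityMeasure μ]
    {d : ℕ} (gbar : X → EuclideanSpace ℝ (Fin d)) (hgbar : Measurable gbar)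
    (hgbar2 : Integrable (fun x => ‖gbar x‖ ^ 2) μ)
    (w : X → ℝ) (hw : Measurable w) (hw01 : ∀ x, w x = 0 ∨ w x = 1)
    (β : ℝ) (hβ : β = ∫ x, w x ∂μ) (hβ0 : 0 < β) (hβ1 : β ≤ 1)
    (m : EuclideanSpace ℝ (Fin d)) (hm : m = ∫ x, (w x / β) • gbar x ∂μ)
    (Vprob : ℝ)
    (hVprob : Vprob = ∫ x, ‖gbar x - m‖ ^ 2 ∂(μ[|{x' | w x' = 1}])) :
    (∫ x, ‖(w x / β) • gbar x - m‖ ^ 2 ∂μ)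
        = Vprob / β + ((1 - β) / β) * ‖m‖ ^ 2
    ∧ m = ∫ x, gbar x ∂(μ[|{x' | w x' = 1}]) := by
  have hcond : ∀ {E : Type} [NormedAddCommGroup E] [NormedSpace ℝ E] (f : X → E),
      ∫ x, f x ∂(μ[|{x' | w x' = 1}]) = ∫ x, (w x / β) • f x ∂μ := by
    intro E _ _ f
    rw [hβ, integral_cond_mask_eq μ hw hw01 f]
  refine ⟨?_, by rw [hcond, hm]⟩
  have hmem : MemLp gbar 2 μ :=
    (memLp_two_iff_integrable_sq_norm hgbar.aestronglyMeasurable).2 hgbar2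
  have hw_le : ∀ x, ‖w x‖ ≤ 1 := fun x => by rcases hw01 x with h | h <;> simp [h]
  have hmask_le : ∀ᵐ x ∂μ, ‖w x / β‖ ≤ β⁻¹ := ae_of_all _ fun x => by
    rw [norm_div, Real.norm_of_nonneg hβ0.le, div_eq_mul_inv]
    exact mul_le_of_le_one_left (inv_nonneg.2 hβ0.le) (hw_le x)
  have hmask : AEStronglyMeasurable (fun x => w x / β) μ := (hw.div_const β).aestronglyMeasurable
  have hw_int : Integrable w μ := .of_bound hw.aestronglyMeasurable 1 (ae_of_all _ hw_le)
  have hg_int : Integrable (fun x => (w x / β) • gbar x) μ :=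
    (hmem.integrable one_le_two).bdd_smul _ hmask hmask_le
  have hdev_int : Integrable (fun x => (w x / β) • ‖gbar x - m‖ ^ 2) μ :=
    (hmem.sub (memLp_const m)).norm.integrable_sq.bdd_smul _ hmask hmask_le
  have hinner_int : Integrable (fun x => inner ℝ m ((w x / β) • gbar x)) μ :=
    hg_int.const_inner m
  have hrest_int : Integrable (fun x => 1 - β⁻¹ ^ 2 * w x) μ :=
    (integrable_const 1).sub (hw_int.const_mul _)
  have hrest : ∫ x, (1 - β⁻¹ ^ 2 * w x) ∂μ = 1 - β⁻¹ ^ 2 * β := by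
    rw [integral_sub (integrable_const 1) (hw_int.const_mul _), integral_const_mul, ← hβ]
    simp
  simp_rw [fun x => norm_sq_mask_smul_sub (gbar x) m (hw01 x) hβ0.ne']
  have hsum_int : Integrable (fun x => β⁻¹ * ((w x / β) • ‖gbar x - m‖ ^ 2)
      + 2 * (β⁻¹ - 1) * inner ℝ m ((w x / β) • gbar x)) μ :=
    (hdev_int.const_mul _).add (hinner_int.const_mul _)
  rw [integral_add hsum_int (hrest_int.const_mul _),
    integral_add (hdev_int.const_mul _) (hinner_int.const_mul _), integral_const_mul,
    integral_const_mul, integral_const_mul, hrest, integral_inner hg_int, ← hm, ← hcond, ← hVprob,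
    real_inner_self_eq_norm_sq]
  field_simp
  ring
end
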